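/- arXiv:2103.01194 — 2 statements merged into one kernel-verified Lean document; each statement's English description precedes it below -/
import Mathlib

section
/- Define the normalized first-order structure-preserving scheme by 𝓐_un(ρ) := (I + ΔtJ) · ρ · (I + ΔtJ)ᴴ + Δt · L ρ Lᴴ and 𝓐(ρ) := 𝓐_un(ρ)/Tr(𝓐_un(ρ)). Then the following are equivalent: (i) for every density matrix ρ_0, Tr(σ_X · 𝓐^{∘k}(ρ_0)) → 0 and Tr(σ_Y · 𝓐^{∘k}(ρ_0)) → 0 as k → ∞; (ii) a·Δt ≠ 4 (that is, Re(z) ≠ 4). -/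
open Filter
open scoped Matrix ComplexOrder

/-- The off-diagonal amplification factor `(u² - s) / (|u|² + s)` for `u = x - iy`. -/
noncomputable def offDiagFactor (x y s : ℝ) : ℂ :=
  ((x - y * Complex.I) ^ 2 - s) / ((x ^ 2 + y ^ 2 + s : ℝ) : ℂ)

theorem norm_offDiagFactor_lt_one {x y s : ℝ} (hx : x ≠ 0) (hs : 0 < s) :
    ‖offDiagFactor x y s‖ < 1 := by
  have hD : 0 < x ^ 2 + y ^ 2 + s := by positivity
  rw [offDiagFactor, norm_div, Complex.norm_real, Real.norm_of_nonneg hD.le, div_lt_one hD]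
  refine lt_of_pow_lt_pow_left₀ 2 hD.le ?_
  rw [← Complex.normSq_eq_norm_sq, Complex.normSq_apply]
  simp only [pow_two, Complex.sub_re, Complex.sub_im, Complex.mul_re, Complex.mul_im,
    Complex.ofReal_re, Complex.ofReal_im, Complex.I_re, Complex.I_im]
  have hxs : 0 < x ^ 2 * s := by positivity
  nlinarith

theorem offDiagFactor_zero_left (y : ℝ) {s : ℝ} (hs : 0 < s) : offDiagFactor 0 y s = -1 := by
  have hD : ((0 ^ 2 + y ^ 2 + s : ℝ) : ℂ) ≠ 0 := by
    exact_mod_cast (by positivity : (0 ^ 2 + y ^ 2 + s : ℝ) ≠ 0)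
  rw [offDiagFactor, div_eq_iff hD]
  push_cast
  linear_combination (y : ℂ) ^ 2 * Complex.I_sq

/-- Iterates of a map that preserves the diagonal and scales the off-diagonal entries of
trace-one matrices. -/
theorem iterate_offDiag_scaling {A : Matrix (Fin 2) (Fin 2) ℂ → Matrix (Fin 2) (Fin 2) ℂ}
    {r r' : ℂ} (hA : ∀ p q w v : ℂ, p + v = 1 → A !![p, q; w, v] = !![p, r * q; r' * w, v])
    {p v : ℂ} (hpv : p + v = 1) (q w : ℂ) (k : ℕ) :
    A^[k] !![p, q; w, v] = !![p, r ^ k * q; r' ^ k * w, v] := by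
  induction k with
  | zero => simp
  | succ k ih =>
    rw [Function.iterate_succ_apply', ih, hA _ _ _ _ hpv, pow_succ', pow_succ', mul_assoc,
      mul_assoc]

/-- Absolute stability of the normalized first-order structure-preserving scheme
(Theorem 9 of the paper): decay holds for every density matrix iff `Re(z) = aΔt ≠ 4`. -/
theorem abs_stability_SP1
    (a b Δt : ℝ) (ha : 0 < a) (hΔt : 0 < Δt) (z : ℂ)
    (hz : z = ((a : ℂ) + (b : ℂ) * Complex.I) * (Δt : ℂ))
    (σX σY σZ H L : Matrix (Fin 2) (Fin 2) ℂ)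
    (hσX : σX = !![0, 1; 1, 0])
    (hσY : σY = !![0, -Complex.I; Complex.I, 0])
    (hσZ : σZ = !![1, 0; 0, -1])
    (hH : H = ((b / 2 : ℝ) : ℂ) • σZ)
    (hL : L = (Real.sqrt (a / 2) : ℂ) • σZ)
    (𝓛 : Matrix (Fin 2) (Fin 2) ℂ → Matrix (Fin 2) (Fin 2) ℂ)
    (h𝓛 : 𝓛 = fun ρ => -Complex.I • (H * ρ - ρ * H) + L * ρ * Lᴴ
        - (1 / 2 : ℂ) • (Lᴴ * L * ρ + ρ * (Lᴴ * L)))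
    (Heff J : Matrix (Fin 2) (Fin 2) ℂ)
    (hHeff : Heff = H - (Complex.I / 2) • (Lᴴ * L))
    (hJ : J = -(Complex.I • Heff))
    (𝓐un 𝓐 : Matrix (Fin 2) (Fin 2) ℂ → Matrix (Fin 2) (Fin 2) ℂ)
    (h𝓐un : 𝓐un = fun ρ => (1 + Δt • J) * ρ * (1 + Δt • J)ᴴ + Δt • (L * ρ * Lᴴ))
    (h𝓐 : 𝓐 = fun ρ => ((𝓐un ρ).trace)⁻¹ • 𝓐un ρ) :
    (∀ ρ0 : Matrix (Fin 2) (Fin 2) ℂ, ρ0.PosSemidef → ρ0.trace = 1 →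
        Tendsto (fun k => (σX * 𝓐^[k] ρ0).trace) atTop (nhds 0) ∧
        Tendsto (fun k => (σY * 𝓐^[k] ρ0).trace) atTop (nhds 0))
      ↔ a * Δt ≠ 4 := by
  set x : ℝ := 1 - a * Δt / 4 with hx
  set y : ℝ := b * Δt / 2 with hy
  set s : ℝ := a * Δt / 2 with hs
  set r := offDiagFactor x y s with hr
  have hs0 : 0 < s := by positivity
  have hD : ((x ^ 2 + y ^ 2 + s : ℝ) : ℂ) ≠ 0 := by
    exact_mod_cast (by positivity : (x ^ 2 + y ^ 2 + s : ℝ) ≠ 0)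
  have hsqrt : (Real.sqrt (a / 2) : ℂ) * Real.sqrt (a / 2) = a / 2 := by
    rw [← Complex.ofReal_mul, Real.mul_self_sqrt (by positivity)]
    push_cast
    rfl
  have hLH : Lᴴ = L := by
    ext i j
    fin_cases i <;> fin_cases j <;> simp [hL, hσZ]
  have hLL : L * L = ((a / 2 : ℂ)) • (1 : Matrix (Fin 2) (Fin 2) ℂ) := by
    rw [hL, smul_mul_smul_comm, hsqrt, hσZ]
    ext i j
    fin_cases i <;> fin_cases j <;> simp
  have hM : 1 + Δt • J = !![(x - y * Complex.I : ℂ), 0; 0, x + y * Complex.I] := by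
    rw [hJ, hHeff, hLH, hLL, hH, hσZ]
    ext i j
    fin_cases i <;> fin_cases j <;> simp [hx, hy]
    · linear_combination (Δt * a / 4 : ℂ) * Complex.I_sq
    · linear_combination (Δt * a / 4 : ℂ) * Complex.I_sq
  have hMH : (1 + Δt • J)ᴴ = !![(x + y * Complex.I : ℂ), 0; 0, x - y * Complex.I] := by
    rw [hM]
    ext i j
    fin_cases i <;> fin_cases j <;> simp [Matrix.conjTranspose_apply, sub_eq_add_neg]
  have hun : ∀ p q w v : ℂ, 𝓐un !![p, q; w, v] = ((x ^ 2 + y ^ 2 + s : ℝ) : ℂ) •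
      !![p, r * q; star r * w, v] := by
    intro p q w v
    have hrD : ((x ^ 2 + y ^ 2 + s : ℝ) : ℂ) * r = (x - y * Complex.I) ^ 2 - s :=
      mul_div_cancel₀ _ hD
    have hrD' : ((x ^ 2 + y ^ 2 + s : ℝ) : ℂ) * star r = (x + y * Complex.I) ^ 2 - s := by
      have := congrArg star hrD
      simpa using this
    have hLρL : L * !![p, q; w, v] * Lᴴ = (a / 2 : ℂ) • !![p, -q; -w, v] := by
      rw [hLH, hL, hσZ, ← hsqrt]
      ext i j
      fin_cases i <;> fin_cases j <;> simp <;> ring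
    have hsC : (s : ℂ) = a * Δt / 2 := by simp [hs]
    push_cast [hsC] at hrD hrD'
    rw [Complex.star_def] at hrD'
    simp only [h𝓐un, hMH, hLρL]
    rw [hM]
    ext i j
    fin_cases i <;> fin_cases j <;> simp [hsC]
    · linear_combination (-y ^ 2 * p : ℂ) * Complex.I_sq
    · linear_combination -q * hrD
    · linear_combination -w * hrD'
    · linear_combination (-y ^ 2 * v : ℂ) * Complex.I_sq
  have hA : ∀ p q w v : ℂ, p + v = 1 →
      𝓐 !![p, q; w, v] = !![p, r * q; star r * w, v] := by
    intro p q w v hpv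
    simp only [h𝓐, hun, Matrix.trace_smul, Matrix.trace_fin_two_of, hpv, smul_eq_mul, mul_one]
    rw [smul_smul, inv_mul_cancel₀ hD, one_smul]
  have hx0 : a * Δt ≠ 4 ↔ x ≠ 0 := by
    rw [hx, not_iff_not]
    constructor <;> intro h <;> linarith
  rw [hx0]
  constructor
  · intro h hx
    have hps : (!![1 / 2, 1 / 2; 1 / 2, 1 / 2] : Matrix (Fin 2) (Fin 2) ℂ).PosSemidef := by
      convert Matrix.posSemidef_conjTranspose_mul_self
        (!![1 / 2, 1 / 2; 1 / 2, 1 / 2] : Matrix (Fin 2) (Fin 2) ℂ) using 1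
      ext i j
      fin_cases i <;> fin_cases j <;> simp [Matrix.mul_apply, map_ofNat] <;> norm_num
    have hlim := (h _ hps (by norm_num [Matrix.trace_fin_two_of])).1
    have hr1 : r = -1 := by rw [hr, hx, offDiagFactor_zero_left y hs0]
    have hval : ∀ k, (σX * 𝓐^[k] !![1 / 2, 1 / 2; 1 / 2, 1 / 2]).trace = (-1 : ℂ) ^ k := by
      intro k
      rw [iterate_offDiag_scaling hA (by norm_num), hσX, hr1]
      simp [Matrix.trace_fin_two]
      ring
    simp only [hval] at hlim
    simpa [tendsto_const_nhds_iff] using hlim.norm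
  · intro hx ρ0 _ htr
    have hr1 : ‖r‖ < 1 := norm_offDiagFactor_lt_one hx hs0
    have hpow := tendsto_pow_atTop_nhds_zero_of_norm_lt_one hr1
    have hpow' := tendsto_pow_atTop_nhds_zero_of_norm_lt_one
      (show ‖star r‖ < 1 by rwa [norm_star])
    rw [Matrix.trace_fin_two] at htr
    rw [Matrix.eta_fin_two ρ0]
    simp only [iterate_offDiag_scaling hA htr, hσX, hσY, Matrix.trace_fin_two]
    constructor
    · simpa using (hpow'.mul_const (ρ0 1 0)).add (hpow.mul_const (ρ0 0 1))
    · simpa using ((hpow'.mul_const (ρ0 1 0)).const_mul (-Complex.I)).add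
        ((hpow.mul_const (ρ0 0 1)).const_mul Complex.I)
end

section
/- For all real numbers x > 0 and w, one has G(x, w) ≥ 0, and G(x, w) = 0 if and only if (x, w) = (4, 2), (x, w) = (4, −2), or (x, w) = (8, 0). -/
/-- The leading coefficient (in `u`) of the quadratic remainder in `square_add_quadratic_nonneg`
is positive. -/
lemma remainder_leadingCoeff_pos (y : ℝ) :
    0 < 2 * y ^ 4 - 14 * y ^ 3 + 44 * y ^ 2 - 40 * y + 16 := by
  nlinarith [sq_nonneg (2 * y ^ 2 - 7 * y), sq_nonneg (39 * y - 40)]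

/-- The linear coefficient of the quadratic remainder is positive for `7 / 5 ≤ y`. -/
lemma remainder_linearCoeff_pos {y : ℝ} (hy : 7 / 5 ≤ y) :
    0 < 4 * y ^ 6 - 40 * y ^ 5 + 144 * y ^ 4 - 196 * y ^ 3 + 152 * y ^ 2 - 112 * y + 32 := by
  obtain ⟨t, ht, rfl⟩ : ∃ t : ℝ, 0 ≤ t ∧ y = 7 / 5 + t := ⟨y - 7 / 5, by linarith, by ring⟩
  nlinarith [pow_nonneg ht 3, mul_nonneg (pow_nonneg ht 3) (sq_nonneg (t - 2)),
    sq_nonneg (t * (t ^ 2 - 4 / 5 * t - 4)), pow_nonneg ht 2]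

/-- Minus the discriminant of the quadratic remainder is `(y - 1) ^ 2` times a polynomial that is
positive on `(0, 7 / 5]`, by its Bernstein expansion there. -/
lemma remainder_discrQuotient_pos {y : ℝ} (hy : 0 < y) (hy' : y ≤ 7 / 5) :
    0 < 3072 - 13312 * y + 38144 * y ^ 2 - 56320 * y ^ 3 + 51520 * y ^ 4 - 24512 * y ^ 5
      + 1968 * y ^ 6 + 2592 * y ^ 7 - 1024 * y ^ 8 + 152 * y ^ 9 - 8 * y ^ 10 := by
  have h (k l : ℕ) : 0 ≤ y ^ k * (7 / 5 - y) ^ l :=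
    mul_nonneg (pow_nonneg hy.le k) (pow_nonneg (by linarith) l)
  linarith [h 0 10, h 1 9, h 2 8, h 3 7, h 4 6, h 5 5, h 6 4, h 7 3, h 8 2, h 9 1, pow_pos hy 10]

/-- The polynomial of the theorem in the coordinates `y = x / 4`, `u = w ^ 2 / 4`, written as a
square plus a quadratic in `u`. -/
lemma square_add_quadratic_nonneg {y u : ℝ} (hy : 0 < y) (hu : 0 ≤ u) :
    0 ≤ (u ^ 2 + (2 * y ^ 2 - 6 * y + 2) * u + y * (y - 2) ^ 2) ^ 2
        + ((2 * y ^ 4 - 14 * y ^ 3 + 44 * y ^ 2 - 40 * y + 16) * u ^ 2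
          + (4 * y ^ 6 - 40 * y ^ 5 + 144 * y ^ 4 - 196 * y ^ 3 + 152 * y ^ 2 - 112 * y + 32) * u
          + (y - 2) ^ 4 * (y ^ 4 - 4 * y ^ 3 + 15 * y ^ 2 - 8 * y + 4)) ∧
      ((u ^ 2 + (2 * y ^ 2 - 6 * y + 2) * u + y * (y - 2) ^ 2) ^ 2
        + ((2 * y ^ 4 - 14 * y ^ 3 + 44 * y ^ 2 - 40 * y + 16) * u ^ 2
          + (4 * y ^ 6 - 40 * y ^ 5 + 144 * y ^ 4 - 196 * y ^ 3 + 152 * y ^ 2 - 112 * y + 32) * u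
          + (y - 2) ^ 4 * (y ^ 4 - 4 * y ^ 3 + 15 * y ^ 2 - 8 * y + 4)) = 0 →
        (y = 1 ∧ u = 1) ∨ (y = 2 ∧ u = 0)) := by
  have hA := remainder_leadingCoeff_pos y
  have hS := sq_nonneg (u ^ 2 + (2 * y ^ 2 - 6 * y + 2) * u + y * (y - 2) ^ 2)
  rcases le_total y (7 / 5) with h | h
  · have hD := remainder_discrQuotient_pos hy h
    set A := 2 * y ^ 4 - 14 * y ^ 3 + 44 * y ^ 2 - 40 * y + 16 with hAdef
    set B := 4 * y ^ 6 - 40 * y ^ 5 + 144 * y ^ 4 - 196 * y ^ 3 + 152 * y ^ 2 - 112 * y + 32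
      with hBdef
    set C := (y - 2) ^ 4 * (y ^ 4 - 4 * y ^ 3 + 15 * y ^ 2 - 8 * y + 4) with hCdef
    set D := 3072 - 13312 * y + 38144 * y ^ 2 - 56320 * y ^ 3 + 51520 * y ^ 4 - 24512 * y ^ 5
      + 1968 * y ^ 6 + 2592 * y ^ 7 - 1024 * y ^ 8 + 152 * y ^ 9 - 8 * y ^ 10 with hDdef
    have hdisc : 4 * A * C - B ^ 2 = (y - 1) ^ 2 * D := by
      rw [hAdef, hBdef, hCdef, hDdef]; ring
    have key : 4 * A * (A * u ^ 2 + B * u + C) = (2 * A * u + B) ^ 2 + (y - 1) ^ 2 * D := by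
      rw [← hdisc]; ring
    have hyD : 0 ≤ (y - 1) ^ 2 * D := by positivity
    have hQ : 0 ≤ A * u ^ 2 + B * u + C := by
      refine nonneg_of_mul_nonneg_right (a := 4 * A) ?_ (by positivity)
      rw [key]; positivity
    refine ⟨by linarith, fun h0 => Or.inl ?_⟩
    have hQ0 : A * u ^ 2 + B * u + C = 0 := by linarith
    rw [hQ0, mul_zero] at key
    have hy1 : y = 1 := by
      have : (y - 1) ^ 2 * D = 0 := by linarith [sq_nonneg (2 * A * u + B)]
      have := (mul_eq_zero.mp this).resolve_right hD.ne'
      linarith [pow_eq_zero_iff two_ne_zero |>.mp this]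
    have hlin : 2 * A * u + B = 0 := by
      rw [← sq_eq_zero_iff]; linarith [sq_nonneg (2 * A * u + B)]
    refine ⟨hy1, ?_⟩
    rw [hAdef, hBdef, hy1] at hlin
    linarith
  · have hB := remainder_linearCoeff_pos h
    have hc : 0 < y ^ 4 - 4 * y ^ 3 + 15 * y ^ 2 - 8 * y + 4 := by
      nlinarith [sq_nonneg (y ^ 2 - 2 * y), sq_nonneg (11 * y - 4)]
    have hAu := mul_nonneg hA.le (sq_nonneg u)
    have hBu := mul_nonneg hB.le hu
    have hC := mul_nonneg (show 0 ≤ (y - 2) ^ 4 by positivity) hc.le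
    refine ⟨by linarith, fun h0 => Or.inr ⟨?_, ?_⟩⟩
    · have hC0 := le_antisymm (by linarith) hC
      have := (mul_eq_zero.mp hC0).resolve_right hc.ne'
      linarith [pow_eq_zero_iff four_ne_zero |>.mp this]
    · have hBu0 := le_antisymm (by linarith) hBu
      exact (mul_eq_zero.mp hBu0).resolve_left hB.ne'

/-- Lemma 10 of the paper: on the half-plane `x > 0`, the polynomial `G(x, w)` is
nonnegative, and it vanishes exactly at `(x, w) = (4, 2)`, `(4, -2)` and `(8, 0)`. -/
theorem G_nonneg_and_zeros (G : ℝ → ℝ → ℝ)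
    (hG : G = fun x w =>
      x ^ 8 - 48 * x ^ 7 + 16 * x ^ 6 * (w ^ 2 + 72) - 192 * x ^ 5 * (3 * w ^ 2 + 88)
        + 32 * x ^ 4 * (3 * w ^ 4 + 232 * w ^ 2 + 4768)
        - 256 * x ^ 3 * (9 * w ^ 4 + 128 * w ^ 2 + 3200)
        + 256 * x ^ 2 * (w ^ 6 + 80 * w ^ 4 + 352 * w ^ 2 + 9728)
        - 1024 * x * (3 * w ^ 6 + 56 * w ^ 4 + 384 * w ^ 2 + 4096)
        + 256 * (w ^ 4 + 8 * w ^ 2 + 128) ^ 2) :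
    ∀ x w : ℝ, 0 < x →
      0 ≤ G x w ∧ (G x w = 0 ↔
        (x = 4 ∧ w = 2) ∨ (x = 4 ∧ w = -2) ∨ (x = 8 ∧ w = 0)) := by
  intro x w hx
  obtain ⟨hnonneg, hzero⟩ :=
    square_add_quadratic_nonneg (y := x / 4) (u := w ^ 2 / 4) (by positivity) (by positivity)
  have hscale : G x w = 65536 *
      (((w ^ 2 / 4) ^ 2 + (2 * (x / 4) ^ 2 - 6 * (x / 4) + 2) * (w ^ 2 / 4)
          + x / 4 * (x / 4 - 2) ^ 2) ^ 2
        + ((2 * (x / 4) ^ 4 - 14 * (x / 4) ^ 3 + 44 * (x / 4) ^ 2 - 40 * (x / 4) + 16)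
            * (w ^ 2 / 4) ^ 2
          + (4 * (x / 4) ^ 6 - 40 * (x / 4) ^ 5 + 144 * (x / 4) ^ 4 - 196 * (x / 4) ^ 3
            + 152 * (x / 4) ^ 2 - 112 * (x / 4) + 32) * (w ^ 2 / 4)
          + (x / 4 - 2) ^ 4
            * ((x / 4) ^ 4 - 4 * (x / 4) ^ 3 + 15 * (x / 4) ^ 2 - 8 * (x / 4) + 4))) := by
    rw [hG]
    ring
  refine ⟨by rw [hscale]; exact mul_nonneg (by norm_num) hnonneg, fun h0 => ?_, ?_⟩
  · rw [hscale] at h0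
    rcases hzero ((mul_eq_zero.mp h0).resolve_left (by norm_num)) with ⟨hx1, hw1⟩ | ⟨hx2, hw0⟩
    · have hx4 : x = 4 := by linarith
      rcases sq_eq_sq_iff_eq_or_eq_neg.mp (show w ^ 2 = 2 ^ 2 by linarith) with hw | hw
      · exact Or.inl ⟨hx4, hw⟩
      · exact Or.inr (Or.inl ⟨hx4, hw⟩)
    · exact Or.inr (Or.inr ⟨by linarith, sq_eq_zero_iff.mp (by linarith)⟩)
  · rintro (⟨rfl, rfl⟩ | ⟨rfl, rfl⟩ | ⟨rfl, rfl⟩) <;> rw [hG] <;> norm_num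
end
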